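/- Suppose (X_A, σ_A) and (X_B, σ_B) are continuously orbit equivalent via a homeomorphism h : X_A → X_B. Let f ∈ C(X_B, ℤ_{≥0}) and g ∈ C(X_A, ℤ_{≥0}) be such that [f] is an order unit of (H^B, H^B_+) and [g] is an order unit of (H^A, H^A_+). Then there exist l_f, k_f ∈ C(X_A, ℤ_{≥0}) and l_g, k_g ∈ C(X_B, ℤ_{≥0}) such that (l_f, k_f, 0) is a suspension triplet for (X_A, σ_A) and (l_g, k_g, 0) is a suspension triplet for (X_B, σ_B), and there exist continuous maps Φ_f : S_A^{l_f,k_f} → S_B^f and Φ_g : S_B^{l_g,k_g} → S_A^g satisfying Φ_f∘φ_{A,t} = φ_{B,t}∘Φ_f and Φ_g∘φ_{B,t} = φ_{A,t}∘Φ_g for all t ≥ 0, Φ_f∘s_A = s_B∘h, and Φ_g∘s_B = s_A∘h^{−1}. -/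

import Mathlib

open scoped BigOperators NNReal

namespace OneSidedMarkov

variable {N M : ℕ}

/-- The matrix has entries in `{0, 1}`. -/
def IsZeroOne (A : Matrix (Fin N) (Fin N) ℤ) : Prop := ∀ i j, A i j = 0 ∨ A i j = 1

/-- The matrix is irreducible. -/
def IsIrreducible (A : Matrix (Fin N) (Fin N) ℤ) : Prop :=
  ∀ i j, ∃ m : ℕ, 0 < m ∧ (A ^ m) i j ≠ 0

/-- The matrix is a permutation matrix. -/
def IsPermutationMatrix (A : Matrix (Fin N) (Fin N) ℤ) : Prop :=
  ∃ e : Equiv.Perm (Fin N), ∀ i j, A i j = if e i = j then 1 else 0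

/-- The one-sided topological Markov shift space `X_A`. -/
abbrev Space (A : Matrix (Fin N) (Fin N) ℤ) : Type :=
  {x : ℕ → Fin N // ∀ n, A (x n) (x (n + 1)) = 1}

/-- The shift map `σ_A`. -/
def shift (A : Matrix (Fin N) (Fin N) ℤ) (x : Space A) : Space A :=
  ⟨fun n => x.1 (n + 1), fun n => x.2 (n + 1)⟩

lemma continuous_shift (A : Matrix (Fin N) (Fin N) ℤ) : Continuous (shift A) := by
  apply Continuous.subtype_mk
  exact continuous_pi fun n => (continuous_apply (n + 1)).comp continuous_subtype_val

/-- The shift map as a continuous map. -/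
def shiftMap (A : Matrix (Fin N) (Fin N) ℤ) : C(Space A, Space A) :=
  ⟨shift A, continuous_shift A⟩

/-- The coboundary subgroup `{ g - g ∘ σ_A }` of `C(X_A, ℤ)`. -/
def cobdySubgroup (A : Matrix (Fin N) (Fin N) ℤ) : AddSubgroup C(Space A, ℤ) :=
  AddSubgroup.closure {f | ∃ g : C(Space A, ℤ), f = g - g.comp (shiftMap A)}

/-- The ordered cohomology group `H^A = C(X_A, ℤ)/{g - g∘σ_A}`. -/
abbrev Coh (A : Matrix (Fin N) (Fin N) ℤ) : Type :=
  C(Space A, ℤ) ⧸ cobdySubgroup A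

/-- The class `[f] ∈ H^A`. -/
def cohClass (A : Matrix (Fin N) (Fin N) ℤ) (f : C(Space A, ℤ)) : Coh A :=
  QuotientAddGroup.mk f

/-- The positive cone `H^A_+`. -/
def CohPos (A : Matrix (Fin N) (Fin N) ℤ) : Set (Coh A) :=
  {c | ∃ f : C(Space A, ℤ), (∀ x, 0 ≤ f x) ∧ c = cohClass A f}

/-- `u` is an order unit of `(H^A, H^A_+)`. -/
def IsOrderUnit (A : Matrix (Fin N) (Fin N) ℤ) (u : Coh A) : Prop :=
  u ∈ CohPos A ∧ ∀ g : Coh A, ∃ n : ℕ, 0 < n ∧ n • u - g ∈ CohPos A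

/-- The data `(l, k, b)` of a suspension. -/
structure SuspData (A : Matrix (Fin N) (Fin N) ℤ) where
  l : C(Space A, ℝ)
  k : C(Space A, ℝ)
  b : C(Space A, ℝ)

/-- `c = l - k`. -/
def cFun {A : Matrix (Fin N) (Fin N) ℤ} (T : SuspData A) (x : Space A) : ℝ :=
  T.l x - T.k x

/-- `(l, k, b)` is a suspension triplet for `(X_A, σ_A)`. -/
def IsSuspTriplet {A : Matrix (Fin N) (Fin N) ℤ} (T : SuspData A) : Prop :=
  (∀ x, 0 ≤ T.l x) ∧ (∀ x, 0 ≤ T.k x) ∧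
  (∃ c : C(Space A, ℤ), (∀ x, (c x : ℝ) = cFun T x) ∧ IsOrderUnit A (cohClass A c)) ∧
  (∀ x, ∃ m : ℕ, T.l x - T.b x = m) ∧
  (∀ x, ∃ m : ℕ, T.k x - T.b (shift A x) = m)

/-- The space `X_{A,b}^ℝ = {(x, r) : r ≥ b(x)}`. -/
abbrev BaseSpace {A : Matrix (Fin N) (Fin N) ℤ} (T : SuspData A) : Type :=
  {p : Space A × ℝ // T.b p.1 ≤ p.2}

/-- The elementary relation `(x, r) ∼ (σ_A(x), r - c(x))` for `r ≥ l(x)`. -/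
def SuspRel {A : Matrix (Fin N) (Fin N) ℤ} (T : SuspData A)
    (p q : BaseSpace T) : Prop :=
  T.l p.1.1 ≤ p.1.2 ∧ q.1 = (shift A p.1.1, p.1.2 - cFun T p.1.1)

/-- The equivalence relation `∼_{l,k}` generated by `SuspRel`. -/
def suspSetoid {A : Matrix (Fin N) (Fin N) ℤ} (T : SuspData A) : Setoid (BaseSpace T) :=
  ⟨Relation.EqvGen (SuspRel T), Relation.EqvGen.is_equivalence _⟩

/-- The one-sided suspension `S_{A,b}^{l,k}` with the quotient topology. -/
abbrev Susp {A : Matrix (Fin N) (Fin N) ℤ} (T : SuspData A) : Type :=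
  Quotient (suspSetoid T)

/-- The class `[x, r]`. -/
def mkSusp {A : Matrix (Fin N) (Fin N) ℤ} (T : SuspData A) (p : BaseSpace T) : Susp T :=
  Quotient.mk (suspSetoid T) p

/-- The base map `x ↦ [x, b(x)]`. -/
def basePoint {A : Matrix (Fin N) (Fin N) ℤ} (T : SuspData A) (x : Space A) : Susp T :=
  mkSusp T ⟨(x, T.b x), le_refl _⟩

/-- Translation by `t ≥ 0` on `X_{A,b}^ℝ`. -/
def shiftPt {A : Matrix (Fin N) (Fin N) ℤ} (T : SuspData A) (t : ℝ≥0)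
    (p : BaseSpace T) : BaseSpace T :=
  ⟨(p.1.1, p.1.2 + t), le_trans p.2 (le_add_of_nonneg_right t.2)⟩

lemma suspRel_shiftPt {A : Matrix (Fin N) (Fin N) ℤ} (T : SuspData A) (t : ℝ≥0)
    {p q : BaseSpace T} (h : SuspRel T p q) : SuspRel T (shiftPt T t p) (shiftPt T t q) := by
  obtain ⟨h1, h2⟩ := h
  refine ⟨le_trans h1 (le_add_of_nonneg_right t.2), ?_⟩
  show (q.1.1, q.1.2 + (t : ℝ)) = _
  rw [h2]
  show (shift A p.1.1, p.1.2 - cFun T p.1.1 + (t : ℝ))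
      = (shift A p.1.1, p.1.2 + (t : ℝ) - cFun T p.1.1)
  congr 1
  ring

lemma eqvGen_map {α : Type*} {r r' : α → α → Prop} (f : α → α)
    (hf : ∀ a b, r a b → r' (f a) (f b)) :
    ∀ a b, Relation.EqvGen r a b → Relation.EqvGen r' (f a) (f b) := by
  intro a b h
  induction h with
  | rel a b hab => exact Relation.EqvGen.rel _ _ (hf a b hab)
  | refl a => exact Relation.EqvGen.refl _
  | symm a b _ ih => exact Relation.EqvGen.symm _ _ ih
  | trans a b c _ _ ih1 ih2 => exact Relation.EqvGen.trans _ _ _ ih1 ih2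

/-- The flow `φ_{A,t}([x, r]) = [x, r + t]`, `t ∈ ℝ_+`, on the one-sided suspension. -/
def flow {A : Matrix (Fin N) (Fin N) ℤ} (T : SuspData A) (t : ℝ≥0) :
    Susp T → Susp T :=
  Quotient.map' (shiftPt T t)
    (fun p q h => eqvGen_map (shiftPt T t) (fun _ _ hr => suspRel_shiftPt T t hr) p q h)

/-- The standard suspension data `(1, 0, 0)`. -/
def stdData (A : Matrix (Fin N) (Fin N) ℤ) : SuspData A := ⟨1, 0, 0⟩

/-- The standard one-sided suspension `S_A^1`. -/
abbrev StdSusp (A : Matrix (Fin N) (Fin N) ℤ) : Type := Susp (stdData A)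

/-- The standard base map `s_A(x) = [x, 0]`. -/
def stdBase (A : Matrix (Fin N) (Fin N) ℤ) : Space A → StdSusp A :=
  basePoint (stdData A)

/-- The orbit equations of a continuous orbit equivalence. -/
def OrbitEqFns (A : Matrix (Fin N) (Fin N) ℤ) (B : Matrix (Fin M) (Fin M) ℤ)
    (h : Space A ≃ₜ Space B) (k1 l1 : C(Space A, ℕ)) (k2 l2 : C(Space B, ℕ)) : Prop :=
  (∀ x : Space A, (shift B)^[k1 x] (h (shift A x)) = (shift B)^[l1 x] (h x)) ∧
  (∀ y : Space B, (shift A)^[k2 y] (h.symm (shift B y)) = (shift A)^[l2 y] (h.symm y))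

/-- `(X_A, σ_A)` and `(X_B, σ_B)` are continuously orbit equivalent. -/
def ContOrbitEquiv (A : Matrix (Fin N) (Fin N) ℤ) (B : Matrix (Fin M) (Fin M) ℤ) : Prop :=
  ∃ h : Space A ≃ₜ Space B, ∃ k1 l1 : C(Space A, ℕ), ∃ k2 l2 : C(Space B, ℕ),
    OrbitEqFns A B h k1 l1 k2 l2

/-- One-sided flow equivalence via the homeomorphism `h`. -/
def FlowEquivVia (A : Matrix (Fin N) (Fin N) ℤ) (B : Matrix (Fin M) (Fin M) ℤ)
    (h : Space A ≃ₜ Space B) : Prop :=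
  ∃ T₁ : SuspData A, IsSuspTriplet T₁ ∧ ∃ T₂ : SuspData B, IsSuspTriplet T₂ ∧
  ∃ Φ₁ : Susp T₁ → StdSusp B, Continuous Φ₁ ∧
  ∃ Φ₂ : Susp T₂ → StdSusp A, Continuous Φ₂ ∧
  (∀ (t : ℝ≥0) (p : Susp T₁), Φ₁ (flow T₁ t p) = flow (stdData B) t (Φ₁ p)) ∧
  (∀ x : Space A, Φ₁ (basePoint T₁ x) = stdBase B (h x)) ∧
  (∀ (t : ℝ≥0) (q : Susp T₂), Φ₂ (flow T₂ t q) = flow (stdData A) t (Φ₂ q)) ∧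
  (∀ y : Space B, Φ₂ (basePoint T₂ y) = stdBase A (h.symm y))

/-- `(X_A, σ_A)` and `(X_B, σ_B)` are one-sided flow equivalent. -/
def OneSidedFlowEquiv (A : Matrix (Fin N) (Fin N) ℤ) (B : Matrix (Fin M) (Fin M) ℤ) : Prop :=
  ∃ h : Space A ≃ₜ Space B, FlowEquivVia A B h

/-- `f^m(x) = Σ_{i<m} f(σ_A^i(x))` for integer-valued `f`. -/
def birk (A : Matrix (Fin N) (Fin N) ℤ) (f : Space A → ℤ) (m : ℕ) (x : Space A) : ℤ :=
  ∑ i ∈ Finset.range m, f ((shift A)^[i] x)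

/-- `f^m(x) = Σ_{i<m} f(σ_A^i(x))` for real-valued `f`. -/
def birkR (A : Matrix (Fin N) (Fin N) ℤ) (f : Space A → ℝ) (m : ℕ) (x : Space A) : ℝ :=
  ∑ i ∈ Finset.range m, f ((shift A)^[i] x)

/-- `f^m(x) = Σ_{i<m} f(σ_A^i(x))` for ℕ-valued `f`. -/
def birkN (A : Matrix (Fin N) (Fin N) ℤ) (f : Space A → ℕ) (m : ℕ) (x : Space A) : ℕ :=
  ∑ i ∈ Finset.range m, f ((shift A)^[i] x)

/-- The map `Ψ_h` associated with a continuous orbit equivalence. -/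
def psi (A : Matrix (Fin N) (Fin N) ℤ) (B : Matrix (Fin M) (Fin M) ℤ)
    (h : Space A → Space B) (l1 k1 : Space A → ℕ) (f : Space B → ℤ) :
    Space A → ℤ :=
  fun x => (∑ i ∈ Finset.range (l1 x), f ((shift B)^[i] (h x)))
    - ∑ j ∈ Finset.range (k1 x), f ((shift B)^[j] (h (shift A x)))

/-- The dynamical zeta function `ζ_{A,f}(s)` with potential `f`. -/
noncomputable def zeta (A : Matrix (Fin N) (Fin N) ℤ) (f : Space A → ℤ) (s : ℂ) : ℂ :=
  Complex.exp (∑' n : ℕ, (1 / (n + 1 : ℂ)) *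
    ∑' x : {x : Space A // (shift A)^[n + 1] x = x},
      Complex.exp (-s * ((birk A f (n + 1) x.1 : ℤ) : ℂ)))

/-- `γ` is a periodic orbit of `(X_A, σ_A)`. -/
def IsPerOrbit (A : Matrix (Fin N) (Fin N) ℤ) (γ : Set (Space A)) : Prop :=
  ∃ (x : Space A) (p : ℕ), 0 < p ∧ (shift A)^[p] x = x ∧
    (∀ q : ℕ, 0 < q → (shift A)^[q] x = x → p ≤ q) ∧
    γ = {y | ∃ i : ℕ, i < p ∧ y = (shift A)^[i] x}

/-- `τ` is a primitive periodic orbit of the flow on the one-sided suspension. -/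
def IsFlowOrbit {A : Matrix (Fin N) (Fin N) ℤ} (T : SuspData A) (τ : Set (Susp T)) : Prop :=
  ∃ u : Susp T, (∃ t : ℝ≥0, 0 < t ∧ flow T t u = u) ∧
    τ = Set.range (fun t : ℝ≥0 => flow T t u)

/-- `ℓ(u) = min { t > 0 : φ_{A,t}(u) = u }`. -/
noncomputable def pointLen {A : Matrix (Fin N) (Fin N) ℤ} (T : SuspData A) (u : Susp T) : ℝ≥0 :=
  sInf {t : ℝ≥0 | 0 < t ∧ flow T t u = u}

/-- `ℓ(τ) = min { t > 0 : φ_{A,t}(u) = u for all u ∈ τ }`. -/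
noncomputable def orbitLen {A : Matrix (Fin N) (Fin N) ℤ} (T : SuspData A)
    (τ : Set (Susp T)) : ℝ≥0 :=
  sInf {t : ℝ≥0 | 0 < t ∧ ∀ u ∈ τ, flow T t u = u}

/-- Cast an integer-valued continuous map to a real-valued one. -/
def toRealCM {X : Type*} [TopologicalSpace X] (f : C(X, ℤ)) : C(X, ℝ) :=
  ⟨fun x => ((f x : ℤ) : ℝ),
    (continuous_of_discreteTopology (f := fun n : ℤ => (n : ℝ))).comp f.continuous⟩

/-- Suspension data `(l, k, 0)` with integer-valued ceiling functions. -/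
def intData {N : ℕ} (A : Matrix (Fin N) (Fin N) ℤ) (l k : C(Space A, ℤ)) : SuspData A :=
  ⟨toRealCM l, toRealCM k, 0⟩

section Combinatorics

variable {A : Matrix (Fin N) (Fin N) ℤ} {B : Matrix (Fin M) (Fin M) ℤ}

/-- The points `x` and `y` have the same first `m` coordinates. -/
def Agree (m : ℕ) (x y : Space A) : Prop := ∀ i < m, x.1 i = y.1 i

lemma Agree.mono {m n : ℕ} (hmn : m ≤ n) {x y : Space A} (h : Agree n x y) : Agree m x y :=
  fun i hi => h i (hi.trans_le hmn)

lemma Agree.symm {m : ℕ} {x y : Space A} (h : Agree m x y) : Agree m y x :=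
  fun i hi => (h i hi).symm

lemma Agree.trans {m : ℕ} {x y z : Space A} (h : Agree m x y) (h' : Agree m y z) :
    Agree m x z :=
  fun i hi => (h i hi).trans (h' i hi)

lemma iterate_shift_apply (n : ℕ) (x : Space A) (i : ℕ) :
    ((shift A)^[n] x).1 i = x.1 (i + n) := by
  induction n generalizing x with
  | zero => rfl
  | succ n ih =>
    rw [Function.iterate_succ_apply, ih]
    exact congrArg x.1 (by omega)

lemma Agree.iterate_shift {m n : ℕ} {x y : Space A} (h : Agree (n + m) x y) :
    Agree m ((shift A)^[n] x) ((shift A)^[n] y) := by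
  intro i hi
  rw [iterate_shift_apply, iterate_shift_apply]
  exact h _ (by omega)

/-- The first `n` coordinates of `x` followed by `y`. -/
def splice (n : ℕ) (x y : Space A) (hxy : x.1 n = y.1 0) : Space A :=
  ⟨fun i => if i < n then x.1 i else y.1 (i - n), fun i => by
    dsimp only
    split_ifs with h1 h2 h2
    · exact x.2 i
    · obtain rfl : n = i + 1 := by omega
      simpa [← hxy] using x.2 i
    · omega
    · rw [Nat.sub_add_comm (by omega)]
      exact y.2 _⟩

lemma iterate_shift_splice (n : ℕ) (x y : Space A) (hxy : x.1 n = y.1 0) :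
    (shift A)^[n] (splice n x y hxy) = y := by
  ext1; funext i
  rw [iterate_shift_apply]
  simp [splice]

lemma splice_agree {n m : ℕ} {x y : Space A} (hxy : x.1 n = y.1 0)
    (h : Agree m ((shift A)^[n] x) y) : Agree (n + m) (splice n x y hxy) x := by
  intro i hi
  simp only [splice]
  split_ifs with h1
  · rfl
  · rw [← h _ (by omega), iterate_shift_apply]
    exact congrArg x.1 (by omega)

lemma splice_agree_self (n : ℕ) {x y : Space A} (hxy : x.1 n = y.1 0) :
    Agree n (splice n x y hxy) x :=
  fun i hi => by simp [splice, hi]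

/-- The periodic point obtained by repeating the first `p` coordinates of `x`. -/
def periodize (p : ℕ) (hp : 0 < p) (x : Space A) (hx : x.1 p = x.1 0) : Space A :=
  ⟨fun i => x.1 (i % p), fun i => by
    have hlt := Nat.mod_lt i hp
    change A (x.1 (i % p)) (x.1 ((i + 1) % p)) = 1
    by_cases h : i % p + 1 < p
    · rw [Nat.add_mod, Nat.mod_eq_of_lt (by omega : 1 < p), Nat.mod_eq_of_lt h]
      exact x.2 _
    · have h1 : i % p + 1 = p := by omega
      have h2 : (i + 1) % p = 0 := by
        rw [← Nat.mod_add_mod, h1, Nat.mod_self]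
      rw [h2, ← hx]
      have := x.2 (i % p)
      rwa [h1] at this⟩

lemma iterate_shift_periodize (p : ℕ) (hp : 0 < p) (x : Space A) (hx : x.1 p = x.1 0) :
    (shift A)^[p] (periodize p hp x hx) = periodize p hp x hx := by
  ext1; funext i
  rw [iterate_shift_apply]
  simp [periodize]

lemma periodize_agree {p m : ℕ} (hp : 0 < p) {x : Space A} (hx : x.1 p = x.1 0)
    (h : Agree m ((shift A)^[p] x) x) : Agree (p + m) (periodize p hp x hx) x := by
  intro i
  induction i using Nat.strong_induction_on with
  | _ i ih =>
    intro hi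
    by_cases hip : i < p
    · simp [periodize, Nat.mod_eq_of_lt hip]
    · have h1 := ih (i - p) (by omega) (by omega)
      have h2 := h (i - p) (by omega)
      rw [iterate_shift_apply, Nat.sub_add_cancel (by omega)] at h2
      rw [h2, ← h1]
      simp only [periodize]
      rw [← Nat.mod_eq_sub_mod (by omega)]

lemma periodize_agree_self {p : ℕ} (hp : 0 < p) {x : Space A} (hx : x.1 p = x.1 0) :
    Agree p (periodize p hp x hx) x :=
  periodize_agree (m := 0) hp hx (fun _ h => absurd h (Nat.not_lt_zero _))

lemma exists_of_pow_ne_zero (hA : IsZeroOne A) {m : ℕ} {i j : Fin N} (hm : (A ^ m) i j ≠ 0)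
    (u : Space A) (hu : u.1 0 = j) : ∃ v : Space A, v.1 0 = i ∧ (shift A)^[m] v = u := by
  induction m generalizing i with
  | zero =>
    refine ⟨u, ?_, rfl⟩
    by_contra hne
    exact hm (by rw [pow_zero, Matrix.one_apply_ne]; rintro rfl; exact hne hu)
  | succ m ih =>
    rw [pow_succ', Matrix.mul_apply] at hm
    obtain ⟨k, -, hk⟩ := Finset.exists_ne_zero_of_sum_ne_zero hm
    obtain ⟨v, hv0, hv⟩ := ih (right_ne_zero_of_mul hk)
    have hik : A i k = 1 := (hA i k).resolve_left (left_ne_zero_of_mul hk)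
    refine ⟨⟨fun n => Nat.casesOn n i v.1, fun n => ?_⟩, rfl, ?_⟩
    · cases n with
      | zero => simpa [hv0] using hik
      | succ n => exact v.2 n
    · rw [Function.iterate_succ_apply]
      exact hv

lemma exists_branching (hA : IsZeroOne A) (hirr : IsIrreducible A)
    (hnp : ¬ IsPermutationMatrix A) :
    ∃ a b b' : Fin N, b ≠ b' ∧ A a b = 1 ∧ A a b' = 1 := by
  by_contra! hcon
  have hrow : ∀ i, ∃ k, A i k = 1 := by
    intro i
    obtain ⟨m, hm, hne⟩ := hirr i i
    obtain ⟨m, rfl⟩ := Nat.exists_eq_succ_of_ne_zero hm.ne'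
    rw [pow_succ', Matrix.mul_apply] at hne
    obtain ⟨k, -, hk⟩ := Finset.exists_ne_zero_of_sum_ne_zero hne
    exact ⟨k, (hA i k).resolve_left (left_ne_zero_of_mul hk)⟩
  choose e he using hrow
  have hsurj : Function.Surjective e := by
    intro j
    obtain ⟨m, hm, hne⟩ := hirr j j
    obtain ⟨m, rfl⟩ := Nat.exists_eq_succ_of_ne_zero hm.ne'
    rw [pow_succ, Matrix.mul_apply] at hne
    obtain ⟨k, -, hk⟩ := Finset.exists_ne_zero_of_sum_ne_zero hne
    refine ⟨k, ?_⟩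
    by_contra hkj
    exact hcon k (e k) j hkj (he k) ((hA k j).resolve_left (right_ne_zero_of_mul hk))
  refine hnp ⟨Equiv.ofBijective e (Finite.injective_iff_surjective.2 hsurj |>.bijective_of_finite),
    fun i j => ?_⟩
  rw [Equiv.ofBijective_apply]
  split_ifs with h
  · rw [← h, he]
  · exact (hA i j).resolve_right (hcon i (e i) j h (he i))

end Combinatorics

section Topology

variable {A : Matrix (Fin N) (Fin N) ℤ}

lemma isOpen_agree (m : ℕ) (x : Space A) : IsOpen {y | Agree m x y} := by
  have : {y : Space A | Agree m x y} =
      ⋂ i ∈ Finset.range m, (fun y : Space A => y.1 i) ⁻¹' {x.1 i} := by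
    ext y
    simp [Agree, eq_comm]
  rw [this]
  exact isOpen_biInter_finset fun i _ => (isOpen_discrete _).preimage
    ((continuous_apply i).comp continuous_subtype_val)

lemma exists_agree_subset {U : Set (Space A)} (hU : IsOpen U) {x : Space A} (hx : x ∈ U) :
    ∃ m, ∀ y, Agree m x y → y ∈ U := by
  obtain ⟨V, hV, rfl⟩ := isOpen_induced_iff.1 hU
  obtain ⟨I, u, hu, hsub⟩ := isOpen_pi_iff.1 hV x.1 hx
  refine ⟨I.sup id + 1, fun y hy => hsub fun i hi => ?_⟩
  rw [← hy i (Nat.lt_succ_of_le (Finset.le_sup (f := id) hi))]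
  exact (hu i hi).2

instance compactSpace_space : CompactSpace (Space A) := by
  have hset : {x : ℕ → Fin N | ∀ n, A (x n) (x (n + 1)) = 1} =
      ⋂ n, {x | A (x n) (x (n + 1)) = 1} := by
    ext x
    simp
  have hclosed : IsClosed {x : ℕ → Fin N | ∀ n, A (x n) (x (n + 1)) = 1} := by
    rw [hset]
    refine isClosed_iInter fun n => ?_
    have hc : Continuous fun x : ℕ → Fin N => (x n, x (n + 1)) := by fun_prop
    exact (isClosed_discrete {q : Fin N × Fin N | A q.1 q.2 = 1}).preimage hc
  exact isCompact_iff_compactSpace.1 hclosed.isCompact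

lemma exists_agree_imp_eq {Y : Type*} [TopologicalSpace Y] [DiscreteTopology Y]
    (c : C(Space A, Y)) : ∃ m, ∀ x y, Agree m x y → c x = c y := by
  have key : ∃ m, ∀ x ∈ (Set.univ : Set (Space A)), ∀ y, Agree m x y → c x = c y := by
    refine isCompact_univ.induction_on (p := fun s => ∃ m, ∀ x ∈ s, ∀ y, Agree m x y → c x = c y)
      ⟨0, by simp⟩ ?_ ?_ ?_
    · rintro s t hst ⟨m, hm⟩
      exact ⟨m, fun x hx => hm x (hst hx)⟩
    · rintro s t ⟨m, hm⟩ ⟨n, hn⟩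
      refine ⟨max m n, ?_⟩
      rintro x (hx | hx) y hxy
      · exact hm x hx y (hxy.mono (le_max_left _ _))
      · exact hn x hx y (hxy.mono (le_max_right _ _))
    · intro x _
      obtain ⟨m, hm⟩ := exists_agree_subset
        ((isOpen_discrete {c x}).preimage c.continuous) (x := x) rfl
      refine ⟨_, mem_nhdsWithin_of_mem_nhds ((isOpen_agree m x).mem_nhds fun _ _ => rfl), m, ?_⟩
      intro y hy z hyz
      exact (hm y hy).trans (hm z (hy.trans hyz)).symm
  simpa using key

lemma continuous_of_agree {Y : Type*} [TopologicalSpace Y] {c : Space A → Y} (m : ℕ)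
    (hc : ∀ x y, Agree m x y → c x = c y) : Continuous c :=
  IsLocallyConstant.continuous <| (IsLocallyConstant.iff_exists_open c).2 fun x =>
    ⟨_, isOpen_agree m x, fun _ _ => rfl, fun y hy => (hc x y hy).symm⟩

lemma birkhoffSum_congr_of_agree {R : Type*} [AddCommMonoid R] {c : Space A → R} {m : ℕ}
    (hc : ∀ x y, Agree m x y → c x = c y) (n : ℕ) {x y : Space A} (hxy : Agree (n + m) x y) :
    birkhoffSum (shift A) c n x = birkhoffSum (shift A) c n y :=
  Finset.sum_congr rfl fun i hi => hc _ _ <|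
    (hxy.mono (by have := Finset.mem_range.1 hi; omega)).iterate_shift

lemma exists_abs_le (c : C(Space A, ℤ)) : ∃ K : ℕ, ∀ x, |c x| ≤ K := by
  obtain ⟨K, hK⟩ := (isCompact_range c.continuous.abs).bddAbove
  refine ⟨K.toNat, fun x => (hK ⟨x, rfl⟩).trans (Int.self_le_toNat K)⟩

lemma birkhoffSum_nonneg {c : Space A → ℤ} (hc : ∀ x, 0 ≤ c x) (n : ℕ) (x : Space A) :
    0 ≤ birkhoffSum (shift A) c n x :=
  Finset.sum_nonneg fun _ _ => hc _

lemma continuous_birkhoffSum {c : Space A → ℤ} (hc : Continuous c) (n : ℕ) :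
    Continuous (birkhoffSum (shift A) c n) :=
  continuous_finsetSum _ fun i _ => hc.comp ((continuous_shift A).iterate i)

end Topology

section Cohomology

variable {A : Matrix (Fin N) (Fin N) ℤ}

lemma mem_cobdySubgroup {f : C(Space A, ℤ)} :
    f ∈ cobdySubgroup A ↔ ∃ g : C(Space A, ℤ), f = g - g.comp (shiftMap A) := by
  refine ⟨fun hf => ?_, fun hf => AddSubgroup.subset_closure hf⟩
  induction hf using AddSubgroup.closure_induction with
  | mem x hx => exact hx
  | zero => exact ⟨0, by ext; simp⟩
  | add x y _ _ hx hy =>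
    obtain ⟨g, rfl⟩ := hx
    obtain ⟨g', rfl⟩ := hy
    exact ⟨g + g', by ext; simp; ring⟩
  | neg x _ hx =>
    obtain ⟨g, rfl⟩ := hx
    exact ⟨-g, by ext; simp; ring⟩

lemma cohClass_eq_iff {f g : C(Space A, ℤ)} :
    cohClass A f = cohClass A g ↔ ∃ u : C(Space A, ℤ), ∀ x, g x = f x + u x - u (shift A x) := by
  unfold cohClass
  rw [QuotientAddGroup.eq, mem_cobdySubgroup]
  refine exists_congr fun u => ?_
  rw [ContinuousMap.ext_iff]
  refine forall_congr' fun x => ?_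
  simp only [ContinuousMap.add_apply, ContinuousMap.neg_apply, ContinuousMap.sub_apply,
    ContinuousMap.comp_apply, shiftMap, ContinuousMap.coe_mk]
  constructor <;> intro h <;> linarith

lemma birkhoffSum_cobdy (f g u : Space A → ℤ) (h : ∀ x, g x = f x + u x - u (shift A x))
    (n : ℕ) (x : Space A) :
    birkhoffSum (shift A) g n x =
      birkhoffSum (shift A) f n x + u x - u ((shift A)^[n] x) := by
  induction n with
  | zero => simp
  | succ n ih =>
    rw [birkhoffSum_succ, birkhoffSum_succ, ih, h, Function.iterate_succ_apply']
    ring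

/-- A function with nonnegative sums over all periodic orbits is cohomologous to a nonnegative
one. -/
lemma exists_nonneg_cobdy (hA : IsZeroOne A) (hirr : IsIrreducible A) (c : C(Space A, ℤ))
    (hc : ∀ x p, 0 < p → (shift A)^[p] x = x → 0 ≤ birkhoffSum (shift A) c p x) :
    ∃ u : C(Space A, ℤ), ∀ x, 0 ≤ c x + u x - u (shift A x) := by
  obtain ⟨m, hm⟩ := exists_agree_imp_eq c
  obtain ⟨K, hK⟩ := exists_abs_le c
  choose q hq0 hq using hirr
  obtain ⟨Q, hQ⟩ : ∃ Q, ∀ i j, q i j ≤ Q := by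
    obtain ⟨Q, hQ⟩ := (Set.finite_range fun s : Fin N × Fin N => q s.1 s.2).bddAbove
    exact ⟨Q, fun i j => hQ ⟨(i, j), rfl⟩⟩
  have hle : ∀ n x, birkhoffSum (shift A) c n x ≤ n * K := by
    intro n x
    refine (Finset.sum_le_card_nsmul _ _ (K : ℤ) fun i _ =>
      (le_abs_self _).trans (hK _)).trans ?_
    simp
  have hbound : ∀ n y, -((m + Q : ℕ) * K : ℤ) ≤ birkhoffSum (shift A) c n y := by
    intro n y
    obtain ⟨v, hv0, hv⟩ := exists_of_pow_ne_zero hA (hq (y.1 (n + m)) (y.1 0)) y rfl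
    set r := q (y.1 (n + m)) (y.1 0) with hr
    set t := splice (n + m) y v hv0.symm with ht
    have ht0 : t.1 (n + m + r) = t.1 0 := by
      have h1 : (shift A)^[n + m + r] t = y := by
        rw [Nat.add_comm, Function.iterate_add_apply, iterate_shift_splice, hv]
      have h2 : Agree 1 t y := (splice_agree (m := 1) hv0.symm (by
        intro i hi
        obtain rfl : i = 0 := by omega
        rw [iterate_shift_apply, hv0]
        simp)).mono (by omega)
      rw [h2 0 (by omega), ← h1, iterate_shift_apply]
      simp
    have hpos : 0 < n + m + r := by have := hq0 (y.1 (n + m)) (y.1 0); omega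
    set z := periodize (n + m + r) hpos t ht0
    have hz : Agree (n + m) z y :=
      ((periodize_agree_self hpos ht0).mono (by omega)).trans (splice_agree_self _ _)
    have h1 := hc z _ hpos (iterate_shift_periodize _ hpos t ht0)
    rw [Nat.add_assoc, birkhoffSum_add, birkhoffSum_congr_of_agree hm n hz] at h1
    have h2 := hle (m + r) ((shift A)^[n] z)
    have h3 : ((m + r : ℕ) : ℤ) * K ≤ (m + Q : ℕ) * K := by
      have := hQ (y.1 (n + m)) (y.1 0)
      gcongr
    linarith
  let S : Space A → Set ℤ := fun x =>
    {k | ∃ n y, (shift A)^[n] y = x ∧ k = birkhoffSum (shift A) c n y}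
  have hSbdd : ∀ x, BddBelow (S x) := fun x =>
    ⟨-((m + Q : ℕ) * K : ℤ), by rintro _ ⟨n, y, -, rfl⟩; exact hbound n y⟩
  have hSne : ∀ x, (S x).Nonempty := fun x => ⟨0, 0, x, rfl, by simp⟩
  have hSsub : ∀ x x', Agree (m + 1) x x' → S x ⊆ S x' := by
    rintro x x' hxx' _ ⟨n, y, rfl, rfl⟩
    have h0 : y.1 n = x'.1 0 := by
      rw [← hxx' 0 (by omega), iterate_shift_apply, Nat.zero_add]
    refine ⟨n, splice n y x' h0, iterate_shift_splice _ _ _ _, ?_⟩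
    exact (birkhoffSum_congr_of_agree hm n ((splice_agree h0 hxx').mono (by omega))).symm
  refine ⟨⟨fun x => sInf (S x), continuous_of_agree (m + 1) fun x x' h =>
    congrArg sInf ((hSsub x x' h).antisymm (hSsub x' x h.symm))⟩, fun x => ?_⟩
  obtain ⟨n, y, hy, hk⟩ := Int.csInf_mem (hSne x) (hSbdd x)
  have : sInf (S (shift A x)) ≤ sInf (S x) + c x := by
    refine csInf_le (hSbdd _) ⟨n + 1, y, ?_, ?_⟩
    · rw [Function.iterate_succ_apply', hy]
    · rw [birkhoffSum_succ, hy, hk]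
  simp only [ContinuousMap.coe_mk]
  linarith

lemma mem_cohPos_of_birkhoffSum_nonneg (hA : IsZeroOne A) (hirr : IsIrreducible A)
    (c : C(Space A, ℤ))
    (hc : ∀ x p, 0 < p → (shift A)^[p] x = x → 0 ≤ birkhoffSum (shift A) c p x) :
    cohClass A c ∈ CohPos A := by
  obtain ⟨u, hu⟩ := exists_nonneg_cobdy hA hirr c hc
  exact ⟨c + u - u.comp (shiftMap A), hu, cohClass_eq_iff.2 ⟨u, fun _ => rfl⟩⟩

lemma birkhoffSum_pos_of_isOrderUnit {c : C(Space A, ℤ)} (hc : IsOrderUnit A (cohClass A c))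
    {x : Space A} {p : ℕ} (hp : 0 < p) (hx : (shift A)^[p] x = x) :
    0 < birkhoffSum (shift A) c p x := by
  obtain ⟨n, -, w, hw, hnw⟩ := hc.2 (cohClass A 1)
  have hcl : cohClass A (n • c - 1) = cohClass A w := hnw
  obtain ⟨u, hu⟩ := cohClass_eq_iff.1 hcl
  have h1 := birkhoffSum_cobdy _ _ _ hu p x
  rw [hx] at h1
  have h2 : 0 ≤ birkhoffSum (shift A) w p x := birkhoffSum_nonneg hw _ _
  have h3 : birkhoffSum (shift A) (n • c - 1 : C(Space A, ℤ)) p x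
      = n * birkhoffSum (shift A) c p x - p := by
    simp [birkhoffSum, Finset.sum_sub_distrib, Finset.mul_sum]
  by_contra! hneg
  have h4 : (n : ℤ) * birkhoffSum (shift A) c p x ≤ 0 :=
    mul_nonpos_of_nonneg_of_nonpos (by positivity) hneg
  omega

/-- A function with positive sums over all periodic orbits is an order unit. -/
lemma isOrderUnit_of_birkhoffSum_pos (hA : IsZeroOne A) (hirr : IsIrreducible A)
    (c : C(Space A, ℤ))
    (hc : ∀ x p, 0 < p → (shift A)^[p] x = x → 0 < birkhoffSum (shift A) c p x) :
    IsOrderUnit A (cohClass A c) := by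
  refine ⟨mem_cohPos_of_birkhoffSum_nonneg hA hirr c fun x p hp hx => (hc x p hp hx).le, ?_⟩
  obtain ⟨u, hu⟩ := exists_nonneg_cobdy hA hirr c fun x p hp hx => (hc x p hp hx).le
  set c' : C(Space A, ℤ) := c + u - u.comp (shiftMap A) with hc'
  have hc'u : ∀ x, c' x = c x + u x - u (shift A x) := fun _ => rfl
  have hc'0 : ∀ x, 0 ≤ c' x := hu
  obtain ⟨m, hm⟩ := exists_agree_imp_eq c'
  set V := Fintype.card (Fin (m + 1) → Fin N) with hV
  have hpos : ∀ x, 1 ≤ birkhoffSum (shift A) c' V x := by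
    intro x
    obtain ⟨a, b, hab, heq⟩ := Fintype.exists_ne_map_eq_of_card_lt
      (fun (j : Fin (V + 1)) (i : Fin (m + 1)) => x.1 (i + j)) (by simp [hV])
    wlog hlt : a < b generalizing a b
    · exact this b a hab.symm heq.symm (lt_of_le_of_ne (not_lt.1 hlt) hab.symm)
    obtain ⟨p, hp⟩ := Nat.exists_eq_add_of_lt (Fin.lt_def.1 hlt)
    set y := (shift A)^[(a : ℕ)] x with hy
    have hag : Agree (m + 1) ((shift A)^[p + 1] y) y := by
      intro i hi
      have := congrFun heq ⟨i, hi⟩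
      simp only at this
      rw [hy, ← Function.iterate_add_apply, iterate_shift_apply, iterate_shift_apply, this]
      exact congrArg x.1 (by omega)
    have h0 : y.1 (p + 1) = y.1 0 := by
      have := hag 0 (by omega)
      rwa [iterate_shift_apply, Nat.zero_add] at this
    have h1 := hc _ _ p.succ_pos (iterate_shift_periodize (p + 1) p.succ_pos y h0)
    have h2 := birkhoffSum_cobdy c c' u hc'u (p + 1) (periodize (p + 1) p.succ_pos y h0)
    rw [iterate_shift_periodize, add_sub_cancel_right] at h2
    rw [← h2, birkhoffSum_congr_of_agree hm _
      ((periodize_agree p.succ_pos h0 hag).mono (by omega))] at h1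
    have hbV : (b : ℕ) ≤ V := by omega
    have h3 : birkhoffSum (shift A) c' b x ≤ birkhoffSum (shift A) c' V x :=
      Finset.sum_le_sum_of_subset_of_nonneg (Finset.range_mono hbV) fun i _ _ => hc'0 _
    have h4 : birkhoffSum (shift A) c' b x = birkhoffSum (shift A) c' a x
        + birkhoffSum (shift A) c' (p + 1) y := by
      rw [hp, Nat.add_assoc, birkhoffSum_add]
    have h5 : 0 ≤ birkhoffSum (shift A) c' a x := birkhoffSum_nonneg hc'0 _ _
    omega
  have hper : ∀ x p, 0 < p → (shift A)^[p] x = x →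
      (p : ℤ) ≤ V * birkhoffSum (shift A) c p x := by
    intro x p hp hx
    have h2 := birkhoffSum_cobdy c c' u hc'u p x
    rw [hx, add_sub_cancel_right] at h2
    have h3 : birkhoffSum (shift A) (birkhoffSum (shift A) c' V) p x
        = V * birkhoffSum (shift A) c' p x := by
      have hinv : ∀ j, birkhoffSum (shift A) c' p ((shift A)^[j] x)
          = birkhoffSum (shift A) c' p x := by
        intro j
        induction j with
        | zero => rfl
        | succ j ih =>
          rw [Function.iterate_succ_apply', ← ih, ← sub_eq_zero,
            birkhoffSum_apply_sub_birkhoffSum, ← Function.iterate_add_apply, Nat.add_comm,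
            Function.iterate_add_apply, hx, sub_self]
      simp only [birkhoffSum, ← Function.iterate_add_apply]
      rw [Finset.sum_comm]
      rw [Finset.sum_congr rfl fun j _ => (?_ : _ = birkhoffSum (shift A) c' p x)]
      · simp [birkhoffSum]
      · rw [← hinv j]
        refine Finset.sum_congr rfl fun i _ => ?_
        rw [← Function.iterate_add_apply, Nat.add_comm]
    rw [← h2, ← h3]
    have := Finset.card_nsmul_le_sum (Finset.range p)
      (fun i => birkhoffSum (shift A) c' V ((shift A)^[i] x)) 1 fun i _ => hpos _
    simpa [birkhoffSum] using this
  intro g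
  obtain ⟨g, rfl⟩ := QuotientAddGroup.mk_surjective g
  obtain ⟨K, hK⟩ := exists_abs_le g
  refine ⟨(K + 1) * (V + 1), by positivity, ?_⟩
  refine mem_cohPos_of_birkhoffSum_nonneg hA hirr (((K + 1) * (V + 1)) • c - g) ?_
  intro x p hp hx
  have h1 := hper x p hp hx
  have h2 := hc x p hp hx
  have h3 : birkhoffSum (shift A) g p x ≤ p * K := by
    refine (Finset.sum_le_card_nsmul _ _ (K : ℤ) fun i _ =>
      (le_abs_self _).trans (hK _)).trans ?_
    simp
  have h4 : birkhoffSum (shift A) (((K + 1) * (V + 1)) • c - g : C(Space A, ℤ)) p x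
      = ((K + 1) * (V + 1)) * birkhoffSum (shift A) c p x - birkhoffSum (shift A) g p x := by
    simp [birkhoffSum, Finset.sum_sub_distrib, Finset.mul_sum]
  rw [h4]
  nlinarith [Int.natCast_nonneg K, Int.natCast_nonneg V]

end Cohomology

section OrbitEquivalence

variable {A : Matrix (Fin N) (Fin N) ℤ} {B : Matrix (Fin M) (Fin M) ℤ}

/-- No iterate of the shift is constant on a nonempty open set. -/
lemma not_iterate_shift_const (hB : IsZeroOne B) (hirr : IsIrreducible B)
    (hnp : ¬ IsPermutationMatrix B) {W : Set (Space B)} (hW : IsOpen W) (hne : W.Nonempty)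
    (n : ℕ) (hconst : ∀ v ∈ W, ∀ v' ∈ W, (shift B)^[n] v = (shift B)^[n] v') : False := by
  obtain ⟨y, hy⟩ := hne
  obtain ⟨r, hr⟩ := exists_agree_subset hW hy
  obtain ⟨a, b, b', hbb', hab, hab'⟩ := exists_branching hB hirr hnp
  obtain ⟨q, -, hq⟩ := hirr (y.1 (max n r)) a
  have key : ∀ d, B a d = 1 → ∃ v ∈ W, ((shift B)^[q + max n r] v).1 1 = d := by
    intro d had
    obtain ⟨s, -, hs⟩ := hirr d (y.1 0)
    obtain ⟨w, hw0, -⟩ := exists_of_pow_ne_zero hB hs y rfl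
    obtain ⟨u, hu0, hu⟩ := exists_of_pow_ne_zero hB (m := 1) (i := a) (j := d)
      (by rw [pow_one, had]; exact one_ne_zero) w hw0
    obtain ⟨t, ht0, ht⟩ := exists_of_pow_ne_zero hB hq u hu0
    refine ⟨splice (max n r) y t ht0.symm, hr _ ?_, ?_⟩
    · exact ((splice_agree_self _ _).mono (le_max_right _ _)).symm
    · rw [Function.iterate_add_apply, iterate_shift_splice, ht, ← hw0, ← hu]
      rfl
  obtain ⟨v, hv, hvb⟩ := key b hab
  obtain ⟨v', hv', hvb'⟩ := key b' hab'
  have : (shift B)^[q + max n r] v = (shift B)^[q + max n r] v' := by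
    obtain ⟨e, he⟩ : ∃ e, q + max n r = e + n := ⟨q + max n r - n, by omega⟩
    rw [he, Function.iterate_add_apply, Function.iterate_add_apply, hconst v hv v' hv']
  exact hbb' (by rw [← hvb, ← hvb', this])

lemma orbit_cocycle {h : Space A → Space B} {k l : Space A → ℕ}
    (horb : ∀ x, (shift B)^[k x] (h (shift A x)) = (shift B)^[l x] (h x)) (n : ℕ) (x : Space A) :
    (shift B)^[birkhoffSum (shift A) k n x] (h ((shift A)^[n] x)) =
      (shift B)^[birkhoffSum (shift A) l n x] (h x) := by
  induction n with
  | zero => simp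
  | succ n ih =>
    rw [birkhoffSum_succ, birkhoffSum_succ, Function.iterate_succ_apply',
      Function.iterate_add_apply, horb, ← Function.iterate_add_apply, Nat.add_comm,
      Function.iterate_add_apply, ih, ← Function.iterate_add_apply, Nat.add_comm]

lemma birkhoffSum_psi {h : Space A → Space B} {k l : Space A → ℕ}
    (horb : ∀ x, (shift B)^[k x] (h (shift A x)) = (shift B)^[l x] (h x)) (f : Space B → ℤ)
    (n : ℕ) (x : Space A) :
    birkhoffSum (shift A) (psi A B h l k f) n x =
      birkhoffSum (shift B) f (birkhoffSum (shift A) l n x) (h x)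
        - birkhoffSum (shift B) f (birkhoffSum (shift A) k n x) (h ((shift A)^[n] x)) := by
  induction n with
  | zero => simp
  | succ n ih =>
    have hcoc := orbit_cocycle horb n x
    rw [birkhoffSum_succ, birkhoffSum_succ, birkhoffSum_succ, ih, Function.iterate_succ_apply']
    set z := (shift A)^[n] x
    set P := birkhoffSum (shift A) l n x
    set Q := birkhoffSum (shift A) k n x
    have hpsi : psi A B h l k f z = birkhoffSum (shift B) f (l z) (h z)
      - birkhoffSum (shift B) f (k z) (h (shift A z)) := rfl
    have h1 := birkhoffSum_add (shift B) f P (l z) (h x)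
    have h2 := birkhoffSum_add (shift B) f (k z) Q (h (shift A z))
    have h3 := birkhoffSum_add (shift B) f Q (l z) (h z)
    have h4 := birkhoffSum_add (shift B) f (l z) Q (h z)
    rw [horb] at h2
    rw [hcoc] at h3
    rw [Nat.add_comm] at h4
    rw [hpsi, Nat.add_comm Q, h1, h2]
    linarith

/-- An orbit equivalence preserves the expanding direction at periodic points. -/
lemma birkhoffSum_lt_of_periodic (hB : IsZeroOne B) (hirr : IsIrreducible B)
    (hnp : ¬ IsPermutationMatrix B) (h : Space A ≃ₜ Space B) (k l : C(Space A, ℕ))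
    (horb : ∀ x, (shift B)^[k x] (h (shift A x)) = (shift B)^[l x] (h x))
    {x : Space A} {p : ℕ} (hp : 0 < p) (hx : (shift A)^[p] x = x) :
    birkhoffSum (shift A) k p x < birkhoffSum (shift A) l p x := by
  by_contra! hle
  obtain ⟨mk, hmk⟩ := exists_agree_imp_eq k
  obtain ⟨ml, hml⟩ := exists_agree_imp_eq l
  set m := max mk ml + 1 with hm
  set P := birkhoffSum (shift A) l p x with hP
  set Q := birkhoffSum (shift A) k p x with hQ
  obtain ⟨d, hd⟩ := Nat.exists_eq_add_of_le hle
  have hxj : ∀ j, (shift A)^[j * p] x = x := fun j => by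
    rw [Nat.mul_comm, Function.iterate_mul]
    exact Function.iterate_fixed hx j
  have h0 : ∀ w, Agree m x w → ∀ j, x.1 (j * p) = w.1 0 := by
    intro w hw j
    rw [← hw 0 (by omega)]
    conv_rhs => rw [← hxj j, iterate_shift_apply, Nat.zero_add]
  have hspl : ∀ w (hw : Agree m x w) j,
      Agree (j * p + m) (splice (j * p) x w (h0 w hw j)) x := fun w hw j =>
    splice_agree _ (by rw [hxj]; exact hw)
  have hstep : ∀ w (hw : Agree m x w) j,
      (shift A)^[p] (splice ((j + 1) * p) x w (h0 w hw (j + 1))) =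
        splice (j * p) x w (h0 w hw j) := by
    intro w hw j
    ext1; funext i
    rw [iterate_shift_apply]
    have hj : (j + 1) * p = j * p + p := by ring
    simp only [splice, hj]
    have hxi : x.1 (i + p) = x.1 i := by
      conv_rhs => rw [← hx, iterate_shift_apply]
    rw [Nat.add_sub_add_right]
    simp only [Nat.add_lt_add_iff_right, hxi]
  have hrel : ∀ w (hw : Agree m x w) j,
      (shift B)^[P] (h (splice (j * p) x w (h0 w hw j))) =
        (shift B)^[j * d] ((shift B)^[P] (h w)) := by
    intro w hw j
    induction j with
    | zero =>
      have : splice (0 * p) x w (h0 w hw 0) = w := by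
        ext1; funext i
        simp [splice]
      rw [this]
      simp
    | succ j ih =>
      have hag := hspl w hw (j + 1)
      have hj : (j + 1) * p = j * p + p := by ring
      have hcoc := orbit_cocycle horb p (splice ((j + 1) * p) x w (h0 w hw (j + 1)))
      rw [birkhoffSum_congr_of_agree hmk p (hag.mono (by omega)),
        birkhoffSum_congr_of_agree hml p (hag.mono (by omega)), ← hP, ← hQ, hstep w hw] at hcoc
      rw [← hcoc, hd, Nat.add_comm, Function.iterate_add_apply, ih, ← Function.iterate_add_apply]
      exact congrArg (fun e => (shift B)^[e] ((shift B)^[P] (h w))) (by ring)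
  have hconv : ∀ r, ∃ J, ∀ j ≥ J, ∀ w (hw : Agree m x w),
      Agree r (h x) (h (splice (j * p) x w (h0 w hw j))) := by
    intro r
    obtain ⟨J, hJ⟩ := exists_agree_subset ((isOpen_agree r (h x)).preimage h.continuous)
      (x := x) (fun _ _ => rfl)
    refine ⟨J, fun j hj w hw => hJ _ ((hspl w hw j).mono ?_).symm⟩
    have := Nat.le_mul_of_pos_right j hp
    omega
  have hcoord : ∀ r, ∃ J, ∀ j ≥ J, ∀ w, Agree m x w → ∀ i < r,
      ((shift B)^[P] (h w)).1 (i + j * d) = (h x).1 (i + P) := by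
    intro r
    obtain ⟨J, hJ⟩ := hconv (r + P)
    refine ⟨J, fun j hj w hw i hi => ?_⟩
    rw [← iterate_shift_apply (j * d), ← hrel w hw, iterate_shift_apply]
    exact (hJ j hj w hw _ (by omega)).symm
  obtain ⟨n, hn⟩ : ∃ n, ∀ w, Agree m x w → ∀ w', Agree m x w' →
      (shift B)^[n] (h w) = (shift B)^[n] (h w') := by
    rcases Nat.eq_zero_or_pos d with rfl | hdpos
    · refine ⟨P, fun w hw w' hw' => ?_⟩
      ext1; funext i
      obtain ⟨J, hJ⟩ := hcoord (i + 1)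
      have h1 := hJ J le_rfl w hw i (by omega)
      have h2 := hJ J le_rfl w' hw' i (by omega)
      simp only [Nat.mul_zero, Nat.add_zero] at h1 h2
      rw [h1, h2]
    · obtain ⟨J, hJ⟩ := hcoord d
      refine ⟨J * d + P, fun w hw w' hw' => ?_⟩
      ext1; funext i
      have hi : i + J * d = i % d + (J + i / d) * d := by
        have := Nat.mod_add_div i d
        rw [Nat.add_mul, Nat.mul_comm (i / d)]
        omega
      rw [Function.iterate_add_apply, Function.iterate_add_apply,
        iterate_shift_apply (J * d), iterate_shift_apply (J * d), hi,
        hJ (J + i / d) (Nat.le_add_right _ _) w hw _ (Nat.mod_lt i hdpos),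
        hJ (J + i / d) (Nat.le_add_right _ _) w' hw' _ (Nat.mod_lt i hdpos)]
  refine not_iterate_shift_const hB hirr hnp (h.isOpenMap _ (isOpen_agree m x))
    ⟨h x, x, fun _ _ => rfl, rfl⟩ n ?_
  rintro _ ⟨w, hw, rfl⟩ _ ⟨w', hw', rfl⟩
  exact hn w hw w' hw'

lemma isOrderUnit_psi (hA : IsZeroOne A) (hAirr : IsIrreducible A) (hB : IsZeroOne B)
    (hBirr : IsIrreducible B) (hBnp : ¬ IsPermutationMatrix B) (h : Space A ≃ₜ Space B)
    (k l : C(Space A, ℕ))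
    (horb : ∀ x, (shift B)^[k x] (h (shift A x)) = (shift B)^[l x] (h x))
    {f : C(Space B, ℤ)} (hf : IsOrderUnit B (cohClass B f)) (c : C(Space A, ℤ))
    (hc : ∀ x, c x = psi A B h l k f x) : IsOrderUnit A (cohClass A c) := by
  refine isOrderUnit_of_birkhoffSum_pos hA hAirr c fun x p hp hx => ?_
  obtain ⟨e, he⟩ := Nat.exists_eq_add_of_lt
    (birkhoffSum_lt_of_periodic hB hBirr hBnp h k l horb hp hx)
  have hcoc := orbit_cocycle horb p x
  have hsum := birkhoffSum_psi horb f p x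
  rw [hx, he] at hsum hcoc
  rw [Nat.add_assoc, birkhoffSum_add, add_sub_cancel_left] at hsum
  have hcp : (c : Space A → ℤ) = psi A B h l k f := funext hc
  rw [hcp, hsum]
  refine birkhoffSum_pos_of_isOrderUnit hf e.succ_pos ?_
  rw [← Function.iterate_add_apply, hcoc]
  exact congrArg (fun q => (shift B)^[q] (h x)) (by omega)

lemma continuous_birkhoffSum_comp {X : Type*} [TopologicalSpace X] (n : C(X, ℕ))
    {φ : X → Space B} (hφ : Continuous φ) (f : C(Space B, ℤ)) :
    Continuous fun x => birkhoffSum (shift B) f (n x) (φ x) := by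
  have : Continuous fun q : ℕ × Space B => birkhoffSum (shift B) f q.1 q.2 :=
    continuous_prod_of_discrete_left.2 fun a => continuous_birkhoffSum f.continuous a
  exact this.comp (n.continuous.prodMk hφ)

end OrbitEquivalence

section Suspension

variable {A : Matrix (Fin N) (Fin N) ℤ} {B : Matrix (Fin M) (Fin M) ℤ}

lemma mkSusp_eq_of_suspRel {T : SuspData A} {p q : BaseSpace T} (h : SuspRel T p q) :
    mkSusp T p = mkSusp T q :=
  Quotient.sound (Relation.EqvGen.rel _ _ h)

lemma mkSusp_intData_eq_iterate {f : C(Space B, ℤ)} (hf0 : ∀ y, 0 ≤ f y) (n : ℕ) (y : Space B)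
    (r s : ℝ) (hr : 0 ≤ r) (hs : 0 ≤ s) (hrs : r = s + birkhoffSum (shift B) f n y) :
    mkSusp (intData B f 0) ⟨(y, r), hr⟩ = mkSusp (intData B f 0) ⟨((shift B)^[n] y, s), hs⟩ := by
  induction n generalizing s with
  | zero =>
    obtain rfl : r = s := by simpa using hrs
    rfl
  | succ n ih =>
    have hfn : (0 : ℝ) ≤ f ((shift B)^[n] y) := by exact_mod_cast hf0 _
    rw [birkhoffSum_succ, Int.cast_add] at hrs
    rw [ih (s + f ((shift B)^[n] y)) (by positivity) (by rw [hrs]; ring)]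
    refine mkSusp_eq_of_suspRel ⟨?_, ?_⟩
    · change (f ((shift B)^[n] y) : ℝ) ≤ s + f ((shift B)^[n] y)
      linarith
    · change ((shift B)^[n + 1] y, s) = (shift B ((shift B)^[n] y),
        s + f ((shift B)^[n] y) - ((f ((shift B)^[n] y) : ℝ) - ((0 : ℤ) : ℝ)))
      rw [Function.iterate_succ_apply']
      simp

/-- The suspension triplet and the flow-commuting map attached to one half of a continuous orbit
equivalence. -/
lemma exists_susp_map (hA : IsZeroOne A) (hAirr : IsIrreducible A) (hB : IsZeroOne B)
    (hBirr : IsIrreducible B) (hBnp : ¬ IsPermutationMatrix B) (h : Space A ≃ₜ Space B)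
    (k l : C(Space A, ℕ))
    (horb : ∀ x, (shift B)^[k x] (h (shift A x)) = (shift B)^[l x] (h x))
    (f : C(Space B, ℤ)) (hf0 : ∀ y, 0 ≤ f y) (hf : IsOrderUnit B (cohClass B f)) :
    ∃ lf kf : C(Space A, ℤ), (∀ x, 0 ≤ lf x) ∧ (∀ x, 0 ≤ kf x) ∧
      IsSuspTriplet (intData A lf kf) ∧
      ∃ Φ : Susp (intData A lf kf) → Susp (intData B f 0), Continuous Φ ∧
        (∀ (t : ℝ≥0) (p : Susp (intData A lf kf)),
          Φ (flow (intData A lf kf) t p) = flow (intData B f 0) t (Φ p)) ∧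
        (∀ x : Space A, Φ (basePoint (intData A lf kf) x) = basePoint (intData B f 0) (h x)) := by
  let lf : C(Space A, ℤ) := ⟨fun x => birkhoffSum (shift B) f (l x) (h x),
    continuous_birkhoffSum_comp l h.continuous f⟩
  let kf : C(Space A, ℤ) := ⟨fun x => birkhoffSum (shift B) f (k x) (h (shift A x)),
    continuous_birkhoffSum_comp k (h.continuous.comp (continuous_shift A)) f⟩
  have hlf0 : ∀ x, 0 ≤ lf x := fun x => birkhoffSum_nonneg hf0 _ _
  have hkf0 : ∀ x, 0 ≤ kf x := fun x => birkhoffSum_nonneg hf0 _ _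
  have hlfR : ∀ x, (0 : ℝ) ≤ lf x := fun x => by exact_mod_cast hlf0 x
  have hkfR : ∀ x, (0 : ℝ) ≤ kf x := fun x => by exact_mod_cast hkf0 x
  let φ : BaseSpace (intData A lf kf) → BaseSpace (intData B f 0) :=
    fun p => ⟨(h p.1.1, p.1.2), p.2⟩
  have hφ : Continuous φ := by
    refine Continuous.subtype_mk ?_ _
    exact (h.continuous.comp (continuous_fst.comp continuous_subtype_val)).prodMk
      (continuous_snd.comp continuous_subtype_val)
  have hrel : ∀ p q, SuspRel (intData A lf kf) p q →
      mkSusp (intData B f 0) (φ p) = mkSusp (intData B f 0) (φ q) := by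
    rintro ⟨⟨x, r⟩, hr⟩ ⟨⟨x', r'⟩, hr'⟩ ⟨h1, h2⟩
    obtain ⟨rfl, h3⟩ := Prod.mk.inj h2
    replace h1 : (lf x : ℝ) ≤ r := h1
    replace h3 : r' = r - ((lf x : ℝ) - kf x) := h3
    change mkSusp (intData B f 0) ⟨(h x, r), hr⟩ =
      mkSusp (intData B f 0) ⟨(h (shift A x), r'), hr'⟩
    rw [mkSusp_intData_eq_iterate hf0 (l x) (h x) r (r - lf x) hr (sub_nonneg.2 h1)
        (sub_add_cancel _ _).symm,
      mkSusp_intData_eq_iterate hf0 (k x) (h (shift A x)) r' (r - lf x) hr' (sub_nonneg.2 h1)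
        (h3.trans (by rw [← sub_add]; rfl))]
    simp only [horb]
  have hgen : ∀ p q, Relation.EqvGen (SuspRel (intData A lf kf)) p q →
      mkSusp (intData B f 0) (φ p) = mkSusp (intData B f 0) (φ q) := by
    intro p q hpq
    induction hpq with
    | rel _ _ h => exact hrel _ _ h
    | refl _ => rfl
    | symm _ _ _ ih => exact ih.symm
    | trans _ _ _ _ _ ih1 ih2 => exact ih1.trans ih2
  refine ⟨lf, kf, hlf0, hkf0, ⟨hlfR, hkfR, ⟨lf - kf, fun x => ?_, ?_⟩, fun x => ?_, fun x => ?_⟩,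
    Quotient.lift (fun p => mkSusp (intData B f 0) (φ p)) hgen, ?_, ?_, fun x => rfl⟩
  · change ((lf x - kf x : ℤ) : ℝ) = (lf x : ℝ) - kf x
    push_cast; rfl
  · exact isOrderUnit_psi hA hAirr hB hBirr hBnp h k l horb hf _ fun x => rfl
  · refine ⟨(lf x).toNat, ?_⟩
    change (lf x : ℝ) - 0 = _
    rw [sub_zero]
    exact_mod_cast (Int.toNat_of_nonneg (hlf0 x)).symm
  · refine ⟨(kf x).toNat, ?_⟩
    change (kf x : ℝ) - 0 = _
    rw [sub_zero]
    exact_mod_cast (Int.toNat_of_nonneg (hkf0 x)).symm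
  · exact (continuous_quotient_mk'.comp hφ).quotient_lift _
  · rintro t ⟨p⟩
    rfl

end Suspension

theorem coe_susp_maps_for_order_units
    {N M : ℕ} (A : Matrix (Fin N) (Fin N) ℤ) (B : Matrix (Fin M) (Fin M) ℤ)
    (hN : 1 < N) (hM : 1 < M) (hA01 : IsZeroOne A) (hB01 : IsZeroOne B)
    (hAirr : IsIrreducible A) (hBirr : IsIrreducible B)
    (hAnp : ¬ IsPermutationMatrix A) (hBnp : ¬ IsPermutationMatrix B)
    (h : Space A ≃ₜ Space B) (k1 l1 : C(Space A, ℕ)) (k2 l2 : C(Space B, ℕ))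
    (horb : OrbitEqFns A B h k1 l1 k2 l2)
    (f : C(Space B, ℤ)) (g : C(Space A, ℤ))
    (hf0 : ∀ y, 0 ≤ f y) (hg0 : ∀ x, 0 ≤ g x)
    (hf : IsOrderUnit B (cohClass B f)) (hg : IsOrderUnit A (cohClass A g)) :
    ∃ (lf kf : C(Space A, ℤ)) (lg kg : C(Space B, ℤ)),
      (∀ x, 0 ≤ lf x) ∧ (∀ x, 0 ≤ kf x) ∧ (∀ y, 0 ≤ lg y) ∧ (∀ y, 0 ≤ kg y) ∧
      IsSuspTriplet (intData A lf kf) ∧ IsSuspTriplet (intData B lg kg) ∧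
      ∃ Φf : Susp (intData A lf kf) → Susp (intData B f 0), Continuous Φf ∧
      ∃ Φg : Susp (intData B lg kg) → Susp (intData A g 0), Continuous Φg ∧
        (∀ (t : ℝ≥0) (p : Susp (intData A lf kf)),
          Φf (flow (intData A lf kf) t p) = flow (intData B f 0) t (Φf p)) ∧
        (∀ x : Space A, Φf (basePoint (intData A lf kf) x) = basePoint (intData B f 0) (h x)) ∧
        (∀ (t : ℝ≥0) (q : Susp (intData B lg kg)),
          Φg (flow (intData B lg kg) t q) = flow (intData A g 0) t (Φg q)) ∧
        (∀ y : Space B, Φg (basePoint (intData B lg kg) y) = basePoint (intData A g 0) (h.symm y)) := by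
  obtain ⟨lf, kf, hlf, hkf, hT, Φf, hΦ, hΦt, hΦb⟩ :=
    exists_susp_map hA01 hAirr hB01 hBirr hBnp h k1 l1 horb.1 f hf0 hf
  obtain ⟨lg, kg, hlg, hkg, hT', Φg, hΦ', hΦt', hΦb'⟩ :=
    exists_susp_map hB01 hBirr hA01 hAirr hAnp h.symm k2 l2 horb.2 g hg0 hg
  exact ⟨lf, kf, lg, kg, hlf, hkf, hlg, hkg, hT, hT', Φf, hΦ, Φg, hΦ', hΦt, hΦb, hΦt', hΦb'⟩

end OneSidedMarkov
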